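/- arXiv:2503.02820 — 2 statements merged into one kernel-verified Lean document; each statement's English description precedes it below -/
import Mathlib

section
/- (Ad(SE(3)) substructure) Let φ, ρ ∈ ℝ³, and let ξ^⋏ denote the 6×6 real matrix fromBlocks(φ^∧, ρ^∧; 0, φ^∧). Then for every ℓ ∈ ℕ, Γ_ℓ(ξ^⋏) = fromBlocks(Γ_ℓ(φ^∧), Γ_ℓ(φ^∧, ρ^∧, φ^∧); 0, Γ_ℓ(φ^∧)). -/
/-- The hat (skew-symmetric) map on `ℝ³`. -/
def hat (φ : Fin 3 → ℝ) : Matrix (Fin 3) (Fin 3) ℝ :=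
  !![0, -φ 2, φ 1; φ 2, 0, -φ 0; -φ 1, φ 0, 0]

/-- `Γ_ℓ(X) = ∑_{m=0}^∞ X^m / (ℓ+m)!` for a square real matrix. -/
noncomputable def Gamma {n : Type*} [Fintype n] [DecidableEq n]
    (ℓ : ℕ) (X : Matrix n n ℝ) : Matrix n n ℝ :=
  ∑' m : ℕ, (((ℓ + m).factorial : ℝ))⁻¹ • X ^ m

/-- `Γ_ℓ(X, Y, Z) = ∑_{m=0}^∞ ∑_{n=0}^∞ X^m Y Z^n / (ℓ+m+n+1)!` for square real matrices. -/
noncomputable def Gamma3 {n : Type*} [Fintype n] [DecidableEq n]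
    (ℓ : ℕ) (X Y Z : Matrix n n ℝ) : Matrix n n ℝ :=
  ∑' m : ℕ, ∑' k : ℕ, (((ℓ + m + k + 1).factorial : ℝ))⁻¹ • (X ^ m * Y * Z ^ k)

/-- The powers of a block upper triangular matrix. -/
theorem fromBlocks_zero_pow_succ {n : Type*} [Fintype n] [DecidableEq n]
    (X Y Z : Matrix n n ℝ) (m : ℕ) :
    (Matrix.fromBlocks X Y 0 Z) ^ (m + 1) =
      Matrix.fromBlocks (X ^ (m + 1))
        (∑ p ∈ Finset.HasAntidiagonal.antidiagonal m, X ^ p.1 * Y * Z ^ p.2) 0 (Z ^ (m + 1)) := by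
  induction m with
  | zero => simp
  | succ m ih =>
    rw [pow_succ', ih, Matrix.fromBlocks_multiply, Finset.Nat.sum_antidiagonal_succ]
    refine Matrix.fromBlocks_inj.2 ⟨by simp [pow_succ'], ?_, by simp, by simp [pow_succ']⟩
    simp [pow_succ', Finset.mul_sum, mul_assoc, add_comm]

section Summability

attribute [local instance] Matrix.linftyOpNormedRing Matrix.linftyOpNormedAlgebra

theorem summable_Gamma {n : Type*} [Fintype n] [DecidableEq n] (ℓ : ℕ) (X : Matrix n n ℝ) :
    Summable fun m : ℕ => (((ℓ + m).factorial : ℝ))⁻¹ • X ^ m := by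
  refine Summable.of_norm_bounded (NormedSpace.norm_expSeries_summable' (𝕂 := ℝ) X) fun m => ?_
  rw [norm_smul, norm_smul, norm_inv, norm_inv, Real.norm_natCast, Real.norm_natCast]
  have : (0 : ℝ) < m.factorial := by positivity
  gcongr
  omega

theorem summable_Gamma3 {n : Type*} [Fintype n] [DecidableEq n] (ℓ : ℕ)
    (X Y Z : Matrix n n ℝ) :
    Summable fun p : ℕ × ℕ =>
      (((ℓ + p.1 + p.2 + 1).factorial : ℝ))⁻¹ • (X ^ p.1 * Y * Z ^ p.2) := by
  have hX := NormedSpace.norm_expSeries_summable' (𝕂 := ℝ) X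
  have hZ := NormedSpace.norm_expSeries_summable' (𝕂 := ℝ) Z
  refine Summable.of_norm_bounded ((hX.mul_of_nonneg hZ (fun _ => norm_nonneg _)
    fun _ => norm_nonneg _).mul_left ‖Y‖) fun p => ?_
  have hfac : ((p.1.factorial : ℝ)) * p.2.factorial ≤ (ℓ + p.1 + p.2 + 1).factorial := by
    have h₁ := Nat.le_of_dvd (Nat.factorial_pos _)
      (Nat.factorial_mul_factorial_dvd_factorial_add p.1 p.2)
    have h₂ : (p.1 + p.2).factorial ≤ (ℓ + p.1 + p.2 + 1).factorial :=
      Nat.factorial_le (by omega)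
    exact_mod_cast h₁.trans h₂
  have hmul : ‖X ^ p.1 * Y * Z ^ p.2‖ ≤ ‖X ^ p.1‖ * ‖Y‖ * ‖Z ^ p.2‖ := norm_mul₃_le
  have hpos : (0 : ℝ) < (p.1.factorial : ℝ) * p.2.factorial := by positivity
  simp only [norm_smul, norm_inv, Real.norm_natCast]
  calc _ ≤ ((p.1.factorial : ℝ) * p.2.factorial)⁻¹ * (‖X ^ p.1‖ * ‖Y‖ * ‖Z ^ p.2‖) := by
        gcongr
    _ = _ := by rw [mul_inv]; ring

end Summability

theorem hasSum_antidiagonal_Gamma3 {n : Type*} [Fintype n] [DecidableEq n] (ℓ : ℕ)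
    (X Y Z : Matrix n n ℝ) :
    HasSum (fun m : ℕ => (((ℓ + (m + 1)).factorial : ℝ))⁻¹ •
      ∑ p ∈ Finset.HasAntidiagonal.antidiagonal m, X ^ p.1 * Y * Z ^ p.2) (Gamma3 ℓ X Y Z) := by
  have hs := summable_Gamma3 ℓ X Y Z
  have h : HasSum _ (Gamma3 ℓ X Y Z) := hs.tsum_prod ▸ hs.hasSum
  rw [← Finset.HasAntidiagonal.sigmaAntidiagonalEquivProd.hasSum_iff] at h
  refine h.sigma fun m => ?_
  convert hasSum_fintype _ using 1
  rw [Finset.smul_sum, ← Finset.sum_coe_sort]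
  refine Finset.sum_congr rfl fun p _ => ?_
  have hp := Finset.HasAntidiagonal.mem_antidiagonal.mp p.2
  simp [Finset.HasAntidiagonal.sigmaAntidiagonalEquivProd, ← hp, add_assoc]

theorem HasSum.matrix_fromBlocks {ι l m n o R : Type*} [AddCommMonoid R] [TopologicalSpace R]
    {A : ι → Matrix n l R} {B : ι → Matrix n m R} {C : ι → Matrix o l R} {D : ι → Matrix o m R}
    {a : Matrix n l R} {b : Matrix n m R} {c : Matrix o l R} {d : Matrix o m R}
    (hA : HasSum A a) (hB : HasSum B b) (hC : HasSum C c) (hD : HasSum D d) :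
    HasSum (fun i => Matrix.fromBlocks (A i) (B i) (C i) (D i)) (Matrix.fromBlocks a b c d) := by
  refine Pi.hasSum.2 fun i => Pi.hasSum.2 fun j => ?_
  rcases i with i | i <;> rcases j with j | j
  · exact Pi.hasSum.1 (Pi.hasSum.1 hA i) j
  · exact Pi.hasSum.1 (Pi.hasSum.1 hB i) j
  · exact Pi.hasSum.1 (Pi.hasSum.1 hC i) j
  · exact Pi.hasSum.1 (Pi.hasSum.1 hD i) j

theorem Gamma_fromBlocks_zero {n : Type*} [Fintype n] [DecidableEq n] (ℓ : ℕ)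
    (X Y Z : Matrix n n ℝ) :
    Gamma ℓ (Matrix.fromBlocks X Y 0 Z) =
      Matrix.fromBlocks (Gamma ℓ X) (Gamma3 ℓ X Y Z) 0 (Gamma ℓ Z) := by
  refine HasSum.tsum_eq ?_
  have hX := (hasSum_nat_add_iff' 1).2 (summable_Gamma ℓ X).hasSum
  have hZ := (hasSum_nat_add_iff' 1).2 (summable_Gamma ℓ Z).hasSum
  rw [← hasSum_nat_add_iff' 1]
  convert hX.matrix_fromBlocks (hasSum_antidiagonal_Gamma3 ℓ X Y Z)
    (hasSum_zero (α := Matrix n n ℝ)) hZ using 1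
  · rfl
  · funext m
    rw [fromBlocks_zero_pow_succ, Matrix.fromBlocks_smul, smul_zero]
  · simp [← Matrix.fromBlocks_one, Matrix.fromBlocks_smul, sub_eq_add_neg, Matrix.fromBlocks_neg,
      Matrix.fromBlocks_add, Gamma]

theorem ad_se3_substructure (φ ρ : Fin 3 → ℝ) (ℓ : ℕ) :
    Gamma ℓ (Matrix.fromBlocks (hat φ) (hat ρ) 0 (hat φ)) =
      Matrix.fromBlocks (Gamma ℓ (hat φ)) (Gamma3 ℓ (hat φ) (hat ρ) (hat φ))
        0 (Gamma ℓ (hat φ)) :=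
  Gamma_fromBlocks_zero ℓ (hat φ) (hat ρ) (hat φ)
end

section
/- (Partial derivative of γ₀, SO(3) case) Fix ρ ∈ ℝ³ and define f : ℝ³ → ℝ³ by f(φ) = Γ₁(φ^∧)·ρ. Then f is differentiable at every φ ∈ ℝ³, and its Fréchet derivative at φ is the linear map δ ↦ (Γ₁(φ^∧, ρ^∧, φ^∧) − (Γ₁(φ^∧)·ρ)^∧ · Γ₁(φ^∧)) · δ. -/
section GammaSeries

open Finset Finset.Nat
open scoped Nat Matrix Matrix.Norms.Operator

section Commute

variable {S : Type*} [Ring S] {y z : S}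

/-- For commuting `y`, `z`, the quotient of `(z + y) ^ (n + 2) - z ^ (n + 2) - y ^ (n + 2)` by `z y`,
written in two ways. -/
theorem Commute.sum_antidiagonal_choose_succ_nsmul (h : Commute z y) (n : ℕ) :
    ∑ p ∈ antidiagonal n, (n + 2).choose (p.1 + 1) • (z ^ p.1 * y ^ p.2) =
      ∑ p ∈ antidiagonal n, (z + y) ^ p.1 * z ^ p.2 +
        ∑ p ∈ antidiagonal n, (z + y) ^ p.1 * y ^ p.2 := by
  induction n with
  | zero => simp [one_add_one_eq_two]
  | succ n ih =>
    have hz (w : S) : ∑ p ∈ antidiagonal (n + 1), (z + y) ^ p.1 * w ^ p.2 =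
        w ^ (n + 1) + (z + y) * ∑ p ∈ antidiagonal n, (z + y) ^ p.1 * w ^ p.2 := by
      simp [sum_antidiagonal_succ, mul_sum, pow_succ', mul_assoc]
    have pascal : ∑ p ∈ antidiagonal (n + 1), (n + 1 + 2).choose (p.1 + 1) • (z ^ p.1 * y ^ p.2) =
        ∑ p ∈ antidiagonal (n + 1), (n + 2).choose p.1 • (z ^ p.1 * y ^ p.2) +
        ∑ p ∈ antidiagonal (n + 1), (n + 2).choose (p.1 + 1) • (z ^ p.1 * y ^ p.2) := by
      rw [← sum_add_distrib]
      refine sum_congr rfl fun p _ => ?_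
      rw [← add_nsmul, ← Nat.choose_succ_succ']
    have hleft : ∑ p ∈ antidiagonal (n + 1), (n + 2).choose p.1 • (z ^ p.1 * y ^ p.2) =
        y ^ (n + 1) +
          z * ∑ p ∈ antidiagonal n, (n + 2).choose (p.1 + 1) • (z ^ p.1 * y ^ p.2) := by
      simp [sum_antidiagonal_succ, mul_sum, pow_succ', mul_assoc,
        (Nat.cast_commute _ z).left_comm]
    have hright : ∑ p ∈ antidiagonal (n + 1), (n + 2).choose (p.1 + 1) • (z ^ p.1 * y ^ p.2) =
        z ^ (n + 1) +
          y * ∑ p ∈ antidiagonal n, (n + 2).choose (p.1 + 1) • (z ^ p.1 * y ^ p.2) := by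
      rw [sum_antidiagonal_succ', mul_sum]
      congr 1
      · simp
      · refine sum_congr rfl fun p _ => ?_
        rw [mul_smul_comm, ← mul_assoc, ← (h.pow_left p.1).eq, mul_assoc, ← pow_succ']
    rw [pascal, hleft, hright, hz, hz, add_add_add_comm, ← add_mul, ih]
    noncomm_ring

theorem Commute.sum_antidiagonal_inv_factorial_smul [Algebra ℝ S] (h : Commute z y) (n : ℕ) :
    ∑ p ∈ antidiagonal n, (((1 + p.1)! : ℝ)⁻¹ * ((1 + p.2)! : ℝ)⁻¹) • (z ^ p.1 * y ^ p.2) =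
      ((n + 2)! : ℝ)⁻¹ • (∑ p ∈ antidiagonal n, (z + y) ^ p.1 * z ^ p.2 +
        ∑ p ∈ antidiagonal n, (z + y) ^ p.1 * y ^ p.2) := by
  rw [← h.sum_antidiagonal_choose_succ_nsmul, smul_sum]
  refine sum_congr rfl fun p hp => ?_
  rw [HasAntidiagonal.mem_antidiagonal] at hp
  subst hp
  rw [← Nat.cast_smul_eq_nsmul ℝ, smul_smul]
  congr 1
  have : p.1 + p.2 + 2 = (p.1 + 1) + (p.2 + 1) := by ring
  rw [this, Nat.cast_add_choose, add_comm 1, add_comm 1]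
  field_simp

end Commute

section BanachAlgebra

variable {𝔸 : Type*} [NormedRing 𝔸] [NormedAlgebra ℝ 𝔸]

/-- The derivative of `X ↦ X ^ (n + 1)`. -/
noncomputable def powSuccDeriv (n : ℕ) (X : 𝔸) : 𝔸 →L[ℝ] 𝔸 :=
  ∑ p ∈ antidiagonal n, ContinuousLinearMap.mulLeftRight ℝ 𝔸 (X ^ p.1) (X ^ p.2)

theorem powSuccDeriv_apply (n : ℕ) (X H : 𝔸) :
    powSuccDeriv n X H = ∑ p ∈ antidiagonal n, X ^ p.1 * H * X ^ p.2 := by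
  simp [powSuccDeriv]

theorem hasFDerivAt_pow_succ (n : ℕ) (X : 𝔸) :
    HasFDerivAt (fun Y : 𝔸 => Y ^ (n + 1)) (powSuccDeriv n X) X := by
  induction n with
  | zero =>
    simp only [zero_add, pow_one]
    refine (hasFDerivAt_id X).congr_fderiv ?_
    ext H
    simp [powSuccDeriv_apply]
  | succ n ih =>
    simp only [pow_succ' _ (n + 1)]
    refine ((hasFDerivAt_id X).mul' ih).congr_fderiv ?_
    ext H
    simp [powSuccDeriv_apply, sum_antidiagonal_succ, mul_sum, pow_succ', mul_assoc, add_comm]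

variable [NormOneClass 𝔸]

theorem norm_inv_factorial_smul_powSuccDeriv_le {r : ℝ} (n : ℕ) {X : 𝔸} (hX : ‖X‖ ≤ r) :
    ‖((n + 2)! : ℝ)⁻¹ • powSuccDeriv n X‖ ≤ r ^ n / n ! := by
  have hr : 0 ≤ r := (norm_nonneg X).trans hX
  have hsum : ‖powSuccDeriv n X‖ ≤ (n + 1) * r ^ n := by
    refine (norm_sum_le_of_le _ (n := fun _ => r ^ n) fun p hp => ?_).trans (by simp)
    rw [← HasAntidiagonal.mem_antidiagonal.1 hp, pow_add]
    refine (ContinuousLinearMap.opNorm_mulLeftRight_apply_apply_le ℝ 𝔸 _ _).trans ?_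
    gcongr
    · exact (norm_pow_le X p.1).trans (by gcongr)
    · exact (norm_pow_le X p.2).trans (by gcongr)
  rw [norm_smul, Real.norm_of_nonneg (by positivity)]
  calc ((n + 2)! : ℝ)⁻¹ * ‖powSuccDeriv n X‖ ≤ ((n + 2)! : ℝ)⁻¹ * ((n + 1) * r ^ n) := by gcongr
    _ = (r ^ n / n !) * (n + 2 : ℝ)⁻¹ := by
      rw [Nat.factorial_succ (n + 1), Nat.factorial_succ n]
      push_cast
      field_simp
      ring
    _ ≤ r ^ n / n ! := mul_le_of_le_one_right (by positivity)
        (inv_le_one_of_one_le₀ (by linarith [n.cast_nonneg (α := ℝ)]))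

theorem summable_norm_inv_factorial_smul_pow (ℓ : ℕ) (X : 𝔸) :
    Summable fun m : ℕ => ‖((ℓ + m)! : ℝ)⁻¹ • X ^ m‖ := by
  refine (Real.summable_pow_div_factorial ‖X‖).of_nonneg_of_le (fun _ => norm_nonneg _) fun m => ?_
  rw [norm_smul, Real.norm_of_nonneg (by positivity), div_eq_inv_mul]
  gcongr
  · exact_mod_cast Nat.le_add_left m ℓ
  · exact norm_pow_le X m

variable [CompleteSpace 𝔸]

theorem summable_inv_factorial_smul_powSuccDeriv (X : 𝔸) :
    Summable fun n : ℕ => ((n + 2)! : ℝ)⁻¹ • powSuccDeriv n X :=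
  .of_norm_bounded (Real.summable_pow_div_factorial ‖X‖) fun n =>
    norm_inv_factorial_smul_powSuccDeriv_le n le_rfl

theorem hasFDerivAt_tsum_inv_factorial_smul_pow (X : 𝔸) :
    HasFDerivAt (fun Y : 𝔸 => ∑' m : ℕ, ((1 + m)! : ℝ)⁻¹ • Y ^ m)
      (∑' n : ℕ, ((n + 2)! : ℝ)⁻¹ • powSuccDeriv n X) X := by
  have hsplit (Y : 𝔸) : ∑' m : ℕ, ((1 + m)! : ℝ)⁻¹ • Y ^ m =
      1 + ∑' n : ℕ, ((n + 2)! : ℝ)⁻¹ • Y ^ (n + 1) := by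
    rw [(summable_norm_inv_factorial_smul_pow 1 Y).of_norm.tsum_eq_zero_add]
    simp [add_comm, add_left_comm]
  simp only [hsplit]
  refine HasFDerivAt.const_add 1 ?_
  have hX : X ∈ Metric.ball (0 : 𝔸) (‖X‖ + 1) := by simp
  refine hasFDerivAt_tsum_of_isPreconnected
    (Real.summable_pow_div_factorial (‖X‖ + 1)) Metric.isOpen_ball
    (convex_ball _ _).isPreconnected
    (fun n Y _ => (hasFDerivAt_pow_succ n Y).const_smul ((n + 2)! : ℝ)⁻¹)
    (fun n Y hY => norm_inv_factorial_smul_powSuccDeriv_le n (mem_ball_zero_iff.1 hY).le)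
    hX ?_ hX
  have := (summable_nat_add_iff 1).2 (summable_norm_inv_factorial_smul_pow 1 X).of_norm
  simpa [add_comm, add_left_comm, add_assoc] using this

theorem summable_inv_factorial_smul_pow_mul_mul_pow (X Y Z : 𝔸) :
    Summable fun p : ℕ × ℕ => ((1 + p.1 + p.2 + 1)! : ℝ)⁻¹ • (X ^ p.1 * Y * Z ^ p.2) := by
  refine .of_norm_bounded (((Real.summable_pow_div_factorial ‖X‖).mul_of_nonneg
    (Real.summable_pow_div_factorial ‖Z‖) (fun _ => by positivity)
    fun _ => by positivity).mul_left ‖Y‖) fun p => ?_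
  have hfac : (p.1 ! * p.2 ! : ℝ) ≤ (1 + p.1 + p.2 + 1)! := by
    exact_mod_cast (Nat.le_of_dvd (Nat.factorial_pos _)
      (Nat.factorial_mul_factorial_dvd_factorial_add p.1 p.2)).trans
        (Nat.factorial_le (by omega))
  rw [norm_smul, Real.norm_of_nonneg (by positivity)]
  calc ((1 + p.1 + p.2 + 1)! : ℝ)⁻¹ * ‖X ^ p.1 * Y * Z ^ p.2‖
      ≤ (p.1 ! * p.2 ! : ℝ)⁻¹ * (‖X‖ ^ p.1 * ‖Y‖ * ‖Z‖ ^ p.2) := by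
        gcongr
        refine (norm_mul₃_le).trans ?_
        gcongr <;> exact norm_pow_le _ _
    _ = ‖Y‖ * (‖X‖ ^ p.1 / p.1 ! * (‖Z‖ ^ p.2 / p.2 !)) := by
        field_simp

/-- The double series defining `Gamma3 1`, summed along antidiagonals. -/
theorem hasSum_antidiagonal_inv_factorial_smul_pow_mul_mul_pow (X Y Z : 𝔸) :
    HasSum (fun n : ℕ => ((n + 2)! : ℝ)⁻¹ • ∑ p ∈ antidiagonal n, X ^ p.1 * Y * Z ^ p.2)
      (∑' m : ℕ, ∑' k : ℕ, ((1 + m + k + 1)! : ℝ)⁻¹ • (X ^ m * Y * Z ^ k)) := by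
  have hs := summable_inv_factorial_smul_pow_mul_mul_pow X Y Z
  rw [← hs.tsum_prod]
  have h := (HasAntidiagonal.sigmaAntidiagonalEquivProd.hasSum_iff.2 hs.hasSum).sigma
    fun n => hasSum_fintype _
  refine h.congr_fun ?_
  intro n
  rw [smul_sum, ← sum_coe_sort]
  refine sum_congr rfl fun p _ => ?_
  have hp := HasAntidiagonal.mem_antidiagonal.1 p.2
  simp [← hp, add_comm, add_left_comm, add_assoc]

/-- The Cauchy product of the image of `∑ X ^ m / (1 + m)!` under `T` with this series. -/
theorem hasSum_antidiagonal_map_inv_factorial_smul_pow_mul (T : 𝔸 →L[ℝ] 𝔸) (X : 𝔸) :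
    HasSum (fun n : ℕ => ∑ p ∈ antidiagonal n,
        T (((1 + p.1)! : ℝ)⁻¹ • X ^ p.1) * (((1 + p.2)! : ℝ)⁻¹ • X ^ p.2))
      (T (∑' m : ℕ, ((1 + m)! : ℝ)⁻¹ • X ^ m) * ∑' m : ℕ, ((1 + m)! : ℝ)⁻¹ • X ^ m) := by
  have hg := summable_norm_inv_factorial_smul_pow 1 X
  have hf : Summable fun m : ℕ => ‖T (((1 + m)! : ℝ)⁻¹ • X ^ m)‖ :=
    (hg.mul_left ‖T‖).of_nonneg_of_le (fun _ => norm_nonneg _) fun _ => T.le_opNorm _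
  rw [T.map_tsum hg.of_norm, tsum_mul_tsum_eq_tsum_sum_antidiagonal_of_summable_norm hf hg]
  exact (summable_norm_sum_mul_antidiagonal_of_summable_norm hf hg).of_norm.hasSum

end BanachAlgebra

section Hat

/-- `hat` as a linear map. -/
def hatLinearMap : (Fin 3 → ℝ) →ₗ[ℝ] Matrix (Fin 3) (Fin 3) ℝ where
  toFun := hat
  map_add' u v := by
    ext i j; fin_cases i <;> fin_cases j <;> simp [hat] <;> ring
  map_smul' c v := by
    ext i j; fin_cases i <;> fin_cases j <;> simp [hat]

theorem hat_mulVec_comm (u v : Fin 3 → ℝ) : hat u *ᵥ v = -(hat v *ᵥ u) := by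
  ext i; fin_cases i <;> simp [hat, Matrix.mulVec, dotProduct, Fin.sum_univ_three] <;> ring

theorem hat_hat_mulVec (u v : Fin 3 → ℝ) :
    hat (hat u *ᵥ v) = hat u * hat v - hat v * hat u := by
  ext i j
  fin_cases i <;> fin_cases j <;>
    simp [hat, Matrix.mulVec, dotProduct, Fin.sum_univ_three] <;> ring

theorem hat_pow_mulVec (u v : Fin 3 → ℝ) (j : ℕ) :
    hat (hat u ^ j *ᵥ v) =
      ((LinearMap.mulLeft ℝ (hat u) - LinearMap.mulRight ℝ (hat u)) ^ j) (hat v) := by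
  induction j with
  | zero => simp
  | succ j ih =>
    rw [pow_succ', ← Matrix.mulVec_mulVec, hat_hat_mulVec, ih, pow_succ']
    simp

theorem sum_antidiagonal_hat_pow (u v : Fin 3 → ℝ) (n : ℕ) :
    ∑ p ∈ antidiagonal n, (((1 + p.1)! : ℝ)⁻¹ • hat (hat u ^ p.1 *ᵥ v)) *
        (((1 + p.2)! : ℝ)⁻¹ • hat u ^ p.2) =
      ((n + 2)! : ℝ)⁻¹ • (∑ p ∈ antidiagonal n, hat u ^ p.1 * hat (hat u ^ p.2 *ᵥ v) +
        ∑ p ∈ antidiagonal n, hat u ^ p.1 * hat v * hat u ^ p.2) := by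
  have hc : Commute (LinearMap.mulLeft ℝ (hat u) - LinearMap.mulRight ℝ (hat u))
      (LinearMap.mulRight ℝ (hat u)) :=
    (LinearMap.commute_mulLeft_right (R := ℝ) (hat u) (hat u)).sub_left (Commute.refl _)
  have hr (T : Module.End ℝ (Matrix (Fin 3) (Fin 3) ℝ)) (hT : Commute T
      (LinearMap.mulRight ℝ (hat u))) (k : ℕ) (M : Matrix (Fin 3) (Fin 3) ℝ) :
      T (M * hat u ^ k) = T M * hat u ^ k := by
    simpa [LinearMap.pow_mulRight] using LinearMap.congr_fun (hT.pow_right k).eq M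
  have h := LinearMap.congr_fun (hc.sum_antidiagonal_inv_factorial_smul n) (hat v)
  simpa [LinearMap.sum_apply, LinearMap.pow_mulLeft, LinearMap.pow_mulRight, hat_pow_mulVec,
    hr _ (hc.pow_left _), smul_smul, mul_assoc, mul_comm] using h

/-- `M ↦ M *ᵥ v` as a continuous linear map. -/
noncomputable def mulVecCLM (v : Fin 3 → ℝ) :
    Matrix (Fin 3) (Fin 3) ℝ →L[ℝ] (Fin 3 → ℝ) :=
  ((Matrix.mulVecBilin ℝ ℝ).flip v).toContinuousLinearMap

theorem mulVecCLM_apply (v : Fin 3 → ℝ) (M : Matrix (Fin 3) (Fin 3) ℝ) :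
    mulVecCLM v M = M *ᵥ v := rfl

/-- `hat` as a continuous linear map. -/
noncomputable def hatCLM : (Fin 3 → ℝ) →L[ℝ] Matrix (Fin 3) (Fin 3) ℝ :=
  hatLinearMap.toContinuousLinearMap

theorem hatCLM_apply (v : Fin 3 → ℝ) : hatCLM v = hat v := rfl

theorem hasSum_antidiagonal_hat_gamma_mul_gamma (u v : Fin 3 → ℝ) :
    HasSum (fun n : ℕ => ∑ p ∈ antidiagonal n,
        (((1 + p.1)! : ℝ)⁻¹ • hat (hat u ^ p.1 *ᵥ v)) * (((1 + p.2)! : ℝ)⁻¹ • hat u ^ p.2))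
      (hat (Gamma 1 (hat u) *ᵥ v) * Gamma 1 (hat u)) := by
  have h := hasSum_antidiagonal_map_inv_factorial_smul_pow_mul (hatCLM ∘L mulVecCLM v) (hat u)
  have hterm (m : ℕ) : (hatCLM ∘L mulVecCLM v) (((1 + m)! : ℝ)⁻¹ • hat u ^ m) =
      ((1 + m)! : ℝ)⁻¹ • hat (hat u ^ m *ᵥ v) := by
    rw [map_smul]
    rfl
  simp only [← hterm]
  exact h

/-- The antidiagonal expansion of `Gamma3 1 - hat (Gamma 1 *ᵥ v) * Gamma 1`. -/
theorem hasSum_gamma3_sub_hat_gamma_mul_gamma (u v : Fin 3 → ℝ) :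
    HasSum (fun n : ℕ => -(((n + 2)! : ℝ)⁻¹ •
        ∑ p ∈ antidiagonal n, hat u ^ p.1 * hat (hat u ^ p.2 *ᵥ v)))
      (Gamma3 1 (hat u) (hat v) (hat u) - hat (Gamma 1 (hat u) *ᵥ v) * Gamma 1 (hat u)) := by
  refine ((hasSum_antidiagonal_inv_factorial_smul_pow_mul_mul_pow
    (hat u) (hat v) (hat u)).sub (hasSum_antidiagonal_hat_gamma_mul_gamma u v)).congr_fun ?_
  intro n
  rw [sum_antidiagonal_hat_pow, smul_add]
  abel

theorem powSuccDeriv_hat_mulVec (n : ℕ) (u v w : Fin 3 → ℝ) :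
    powSuccDeriv n (hat u) (hat w) *ᵥ v =
      -((∑ p ∈ antidiagonal n, hat u ^ p.1 * hat (hat u ^ p.2 *ᵥ v)) *ᵥ w) := by
  rw [powSuccDeriv_apply, Matrix.sum_mulVec, Matrix.sum_mulVec, ← sum_neg_distrib]
  refine sum_congr rfl fun p _ => ?_
  rw [← Matrix.mulVec_mulVec, ← Matrix.mulVec_mulVec, hat_mulVec_comm w, Matrix.mulVec_neg,
    ← Matrix.mulVec_mulVec]

end Hat

end GammaSeries

open scoped Matrix.Norms.Operator in
theorem hasFDerivAt_gamma1_mulVec (ρ : Fin 3 → ℝ) (φ : Fin 3 → ℝ) :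
    HasFDerivAt (fun ψ : Fin 3 → ℝ => (Gamma 1 (hat ψ)).mulVec ρ)
      (LinearMap.toContinuousLinearMap
        (Matrix.mulVecLin
          (Gamma3 1 (hat φ) (hat ρ) (hat φ) -
            hat ((Gamma 1 (hat φ)).mulVec ρ) * Gamma 1 (hat φ)))) φ := by
  have hderiv := (mulVecCLM ρ).hasFDerivAt.comp φ
    ((hasFDerivAt_tsum_inv_factorial_smul_pow (hat φ)).comp φ hatCLM.hasFDerivAt)
  refine hderiv.congr_fderiv (ContinuousLinearMap.ext fun δ => ?_)
  have hleft := ((summable_inv_factorial_smul_powSuccDeriv (hat φ)).hasSum.mapL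
    (ContinuousLinearMap.apply ℝ _ (hat δ))).mapL (mulVecCLM ρ)
  have hright := (hasSum_gamma3_sub_hat_gamma_mul_gamma φ ρ).mapL (mulVecCLM δ)
  refine hleft.unique (hright.congr_fun fun n => ?_)
  simp [mulVecCLM_apply, Matrix.smul_mulVec, Matrix.neg_mulVec, powSuccDeriv_hat_mulVec]
end
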